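/- There is no finite indecomposable crossed set X with profile 1^{m₀} l₁ l₂ l₃, where 1 < l₁ < l₂ < l₃, l₁ ∤ l₂, l₁ ∤ l₃, l₂ ∤ l₃, and for each k ∈ {1, 2, 3} (indices mod 3) l_k divides lcm(l_{k+1}, l_{k+2}). -/

import Mathlib

open Equiv Equiv.Perm

/-- The length of the cycle of `σ` through `y`, with value `0` when `y` is fixed. -/
def cycleLength {X : Type} [Fintype X] [DecidableEq X] (σ : Perm X) (y : X) : ℕ :=
  (σ.cycleOf y).support.card

section CycleLength

variable {X : Type} [Fintype X] [DecidableEq X] {σ g : Perm X} {y z : X}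

theorem cycleLength_eq_zero : cycleLength σ y = 0 ↔ σ y = y := by
  simp [cycleLength]

theorem cycleLength_eq_zero_or_mem_cycleType (σ : Perm X) (y : X) :
    cycleLength σ y = 0 ∨ cycleLength σ y ∈ σ.cycleType := by
  by_cases hy : σ y = y
  · exact Or.inl (cycleLength_eq_zero.2 hy)
  · right
    rw [cycleType_def]
    exact Multiset.mem_map_of_mem (Finset.card ∘ support)
      (cycleOf_mem_cycleFactorsFinset_iff.2 (mem_support.2 hy))

theorem cycleLength_dvd_of_pow_apply_eq {n : ℕ} (h : (σ ^ n) y = y) (hy : σ y ≠ y) :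
    cycleLength σ y ∣ n := by
  have hc := isCycle_cycleOf σ hy
  rw [cycleLength, ← hc.orderOf, orderOf_dvd_iff_pow_eq_one, hc.pow_eq_one_iff]
  exact ⟨y, by rwa [cycleOf_apply_self], by rwa [cycleOf_pow_apply_self]⟩

theorem pow_cycleLength_apply (σ : Perm X) (y : X) : (σ ^ cycleLength σ y) y = y := by
  rw [cycleLength, ← pow_mod_card_support_cycleOf_self_apply]
  simp

theorem cycleLength_conj (g σ : Perm X) (y : X) :
    cycleLength (g * σ * g⁻¹) (g y) = cycleLength σ y := by
  have h : ((g * σ * g⁻¹).cycleOf (g y)).support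
      = ((σ.cycleOf y).support).map g.toEmbedding := by
    ext w
    rw [mem_support_cycleOf_iff, sameCycle_conj, Finset.mem_map_equiv, mem_support_cycleOf_iff]
    simp [Perm.inv_def]
  rw [cycleLength, h, Finset.card_map, cycleLength]

theorem cycleLength_apply_of_commute (h : Commute g σ) (y : X) :
    cycleLength σ (g y) = cycleLength σ y := by
  rw [← cycleLength_conj g σ y, h.eq, mul_inv_cancel_right]

theorem sameCycle_of_cycleLength_eq (hnd : σ.cycleType.Nodup)
    (h : cycleLength σ y = cycleLength σ z) (hy : σ y ≠ y) : σ.SameCycle y z := by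
  have hz : σ z ≠ z := by
    rw [Ne, ← cycleLength_eq_zero] at hy ⊢
    rwa [← h]
  rw [cycleType_def] at hnd
  rw [sameCycle_iff_cycleOf_eq_of_mem_support (mem_support.2 hy) (mem_support.2 hz)]
  exact Multiset.inj_on_of_nodup_map hnd _
    (cycleOf_mem_cycleFactorsFinset_iff.2 (mem_support.2 hy)) _
    (cycleOf_mem_cycleFactorsFinset_iff.2 (mem_support.2 hz)) h

theorem card_filter_cycleLength_eq (hnd : σ.cycleType.Nodup) {l : ℕ} (hl : l ∈ σ.cycleType) :
    (Finset.univ.filter fun y => cycleLength σ y = l).card = l := by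
  have hl' := hl
  rw [cycleType_def, Multiset.mem_map] at hl'
  obtain ⟨c, hc, rfl⟩ := hl'
  have hc' : c ∈ σ.cycleFactorsFinset := hc
  obtain ⟨y, hy⟩ := (mem_cycleFactorsFinset_iff.1 hc').1.nonempty_support
  have hcy := cycle_is_cycleOf hy hc'
  have hys : σ y ≠ y := mem_support.1 (mem_cycleFactorsFinset_support_le hc' hy)
  subst hcy
  have : (Finset.univ.filter fun z => cycleLength σ z = (σ.cycleOf y).support.card)
      = (σ.cycleOf y).support := by
    ext z
    rw [mem_support_cycleOf_iff' hys, Finset.mem_filter_univ]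
    refine ⟨fun h => sameCycle_of_cycleLength_eq hnd h.symm hys, fun h => ?_⟩
    rw [cycleLength, h.cycleOf_eq]
  exact congrArg Finset.card this

end CycleLength


/-- There is no finite indecomposable crossed set with profile
`1^{m₀} l₁ l₂ l₃` where `1 < l₁ < l₂ < l₃`, `l₁ ∤ l₂`, `l₁ ∤ l₃`, `l₂ ∤ l₃`,
and each `l_k` divides the lcm of the other two. -/
theorem stmt_14 (X : Type) [Fintype X] [DecidableEq X] [Nonempty X]
    (op : X → X → X)
    (φ : X → Equiv.Perm X)
    (hφ : ∀ x y : X, φ x y = op x y)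
    (hsd : ∀ x y z : X, op x (op y z) = op (op x y) (op x z))
    (hq : ∀ x : X, op x x = x)
    (hcr : ∀ x y : X, op y x = x → op x y = y)
    (hind : ∀ u v : X, ∃ g ∈ Subgroup.closure (Set.range φ), g u = v)
    (l₁ l₂ l₃ : ℕ)
    (h1 : 1 < l₁) (h12 : l₁ < l₂) (h23 : l₂ < l₃)
    (hnd12 : ¬ l₁ ∣ l₂) (hnd13 : ¬ l₁ ∣ l₃) (hnd23 : ¬ l₂ ∣ l₃)
    (hd1 : l₁ ∣ Nat.lcm l₂ l₃) (hd2 : l₂ ∣ Nat.lcm l₃ l₁) (hd3 : l₃ ∣ Nat.lcm l₁ l₂)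
    (hprofile : ∀ x : X, (φ x).cycleType = {l₁, l₂, l₃}) :
    False := by
  have hl0 : ∀ l ∈ ({l₁, l₂, l₃} : Multiset ℕ), l ≠ 0 := by
    intro l hl
    simp only [Multiset.insert_eq_cons, Multiset.mem_cons, Multiset.mem_singleton] at hl
    omega
  have hnd : ∀ x, (φ x).cycleType.Nodup := by
    intro x
    rw [hprofile x]
    simp only [Multiset.insert_eq_cons, Multiset.nodup_cons, Multiset.mem_cons,
      Multiset.mem_singleton, Multiset.nodup_singleton, and_true]
    omega
  have hmove : ∀ x y, cycleLength (φ x) y ∈ ({l₁, l₂, l₃} : Multiset ℕ) → φ x y ≠ y :=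
    fun x y h => cycleLength_eq_zero.not.1 (hl0 _ h)
  have hconj : ∀ g ∈ Subgroup.closure (Set.range φ), ∀ x, φ (g x) = g * φ x * g⁻¹ := by
    intro g hg
    induction hg using Subgroup.closure_induction with
    | mem g hg =>
      obtain ⟨z, rfl⟩ := hg
      intro x
      rw [eq_mul_inv_iff_mul_eq]
      ext w
      simp only [Perm.mul_apply, hφ]
      rw [hsd z x w]
    | one => simp
    | mul a b _ _ ha hb =>
      intro x
      rw [Perm.mul_apply, ha, hb]
      group
    | inv a _ ha =>
      intro x
      have h := ha (a⁻¹ x)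
      rw [← Perm.mul_apply, mul_inv_cancel, Perm.one_apply] at h
      rw [h]
      group
  have hφmem : ∀ x, φ x ∈ Subgroup.closure (Set.range φ) :=
    fun x => Subgroup.subset_closure ⟨x, rfl⟩
  have hinv : ∀ g ∈ Subgroup.closure (Set.range φ), ∀ x y,
      cycleLength (φ (g x)) (g y) = cycleLength (φ x) y := by
    intro g hg x y
    rw [hconj g hg, cycleLength_conj]
  -- elements outside the fixed points of `φ x` form single orbitals, one for each length
  have horb : ∀ x y x' y', cycleLength (φ x) y ∈ ({l₁, l₂, l₃} : Multiset ℕ) →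
      cycleLength (φ x') y' = cycleLength (φ x) y →
      cycleLength (φ y') x' = cycleLength (φ y) x := by
    intro x y x' y' hmem h
    obtain ⟨g, hg, rfl⟩ := hind x x'
    rw [← hinv g hg x y] at h hmem
    obtain ⟨k, hk⟩ := sameCycle_of_cycleLength_eq (hnd _) h.symm (hmove _ _ hmem)
    have hx : ((φ (g x)) ^ k) (g x) = g x :=
      zpow_apply_eq_self_of_apply_eq_self (by rw [hφ, hq]) k
    rw [← hinv g hg y x, ← hinv _ (Subgroup.zpow_mem _ (hφmem (g x)) k) (g y) (g x), hk, hx]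
  have hmem : ∀ x y, φ x y ≠ y → cycleLength (φ x) y ∈ ({l₁, l₂, l₃} : Multiset ℕ) := by
    intro x y h
    rw [← hprofile x]
    exact (cycleLength_eq_zero_or_mem_cycleType _ _).resolve_left (cycleLength_eq_zero.not.2 h)
  have hcr' : ∀ x y, φ y x = x → φ x y = y := by
    intro x y h
    rw [hφ] at h ⊢
    exact hcr x y h
  have hsum : ∀ l ∈ ({l₁, l₂, l₃} : Multiset ℕ),
      (Finset.univ.filter fun q : X × X => cycleLength (φ q.1) q.2 = l).card
        = Fintype.card X * l := by
    intro l hl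
    rw [Finset.card_filter, Fintype.sum_prod_type]
    simp_rw [← Finset.card_filter]
    rw [Finset.sum_congr rfl fun x _ =>
      card_filter_cycleLength_eq (hnd x) (by rw [hprofile x]; exact hl)]
    simp
  have hle : ∀ x y, φ x y ≠ y → cycleLength (φ x) y ≤ cycleLength (φ y) x := by
    intro x y h
    have h1 := hmem x y h
    have h2 := hmem y x (fun h' => h (hcr' _ _ h'))
    have hcard : 0 < Fintype.card X := Fintype.card_pos
    refine Nat.le_of_mul_le_mul_left ?_ hcard
    rw [← hsum _ h1, ← hsum _ h2]
    refine Finset.card_le_card_of_injOn Prod.swap ?_ Prod.swap_injective.injOn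
    intro q hq'
    simp only [Finset.coe_filter, Finset.mem_univ, true_and, Set.mem_ofPred_eq] at hq' ⊢
    exact horb x y q.1 q.2 h1 hq'
  have hsymm : ∀ x y, cycleLength (φ x) y = cycleLength (φ y) x := by
    intro x y
    by_cases h : φ x y = y
    · rw [cycleLength_eq_zero.2 h, cycleLength_eq_zero.2 (hcr' _ _ h)]
    · exact le_antisymm (hle _ _ h) (hle _ _ fun h' => h (hcr' _ _ h'))
  have htri : ∀ x y z, φ x y ≠ y → φ x z ≠ z → cycleLength (φ y) z = cycleLength (φ x) y →
      cycleLength (φ x) z ∣ cycleLength (φ x) y := by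
    intro x y z hxy hxz h
    obtain ⟨k, rfl⟩ := sameCycle_of_cycleLength_eq (hnd y)
      (h.trans (hsymm x y)).symm (fun h' => hxy (hcr' _ _ h'))
    refine cycleLength_dvd_of_pow_apply_eq ?_ hxz
    have hcomm : Commute (φ x ^ cycleLength (φ x) y) (φ y) := by
      have := hconj _ (Subgroup.pow_mem _ (hφmem x) (cycleLength (φ x) y)) y
      rw [pow_cycleLength_apply, eq_mul_inv_iff_mul_eq] at this
      exact this.symm
    have hx : (φ x ^ cycleLength (φ x) y) x = x :=
      pow_apply_eq_self_of_apply_eq_self (by rw [hφ, hq]) _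
    rw [← Perm.mul_apply, (hcomm.zpow_right k).eq, Perm.mul_apply, hx]
  have hfix : ∀ x y z, φ x y ≠ y → φ x z ≠ z → φ y z = z →
      cycleLength (φ x) z ≤ cycleLength (φ x) y := by
    intro x y z hxy hxz h
    rw [hsymm x z, hsymm x y]
    have hyx : φ y x ≠ x := fun h' => hxy (hcr' _ _ h')
    have hzx : φ z x ≠ x := fun h' => hxz (hcr' _ _ h')
    have hcomm : Commute (φ z) (φ y) := by
      have := hconj _ (hφmem z) y
      rw [hcr' _ _ h, eq_mul_inv_iff_mul_eq] at this
      exact this.symm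
    refine Finset.card_le_card fun w hw => ?_
    rw [mem_support_cycleOf_iff' hzx] at hw
    rw [mem_support_cycleOf_iff' hyx]
    obtain ⟨k, rfl⟩ := hw
    exact sameCycle_of_cycleLength_eq (hnd y)
      (cycleLength_apply_of_commute (hcomm.zpow_left k) x).symm hyx
  obtain ⟨x⟩ := ‹Nonempty X›
  have hcard := fun x l hl => card_filter_cycleLength_eq (hnd x) (l := l)
    (by rw [hprofile x]; exact hl)
  have hex : (Finset.univ.filter fun y => cycleLength (φ x) y = l₁).Nonempty := by
    rw [← Finset.card_pos, hcard x l₁ (by simp)]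
    omega
  obtain ⟨y, hy⟩ := hex
  rw [Finset.mem_filter_univ] at hy
  have hxy : φ x y ≠ y := hmove _ _ (by rw [hy]; simp)
  have hsub : l₃ ≤ l₂ := by
    rw [← hcard x l₃ (by simp), ← hcard y l₂ (by simp)]
    refine Finset.card_le_card fun z hz => ?_
    rw [Finset.mem_filter_univ] at hz ⊢
    have hxz : φ x z ≠ z := hmove _ _ (by rw [hz]; simp)
    by_cases hyz : φ y z = z
    · have := hfix x y z hxy hxz hyz
      omega
    have hm := hmem y z hyz
    simp only [Multiset.insert_eq_cons, Multiset.mem_cons, Multiset.mem_singleton] at hm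
    rcases hm with hm | hm | hm
    · have := Nat.le_of_dvd (by omega) (htri x y z hxy hxz (by rw [hm, hy]))
      omega
    · exact hm
    · have h := htri y z x hyz (fun h' => hxy (hcr' _ _ h')) (by rw [← hsymm x z, hz, hm])
      rw [← hsymm x y, hy, hm] at h
      exact absurd h hnd13
  omega
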